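/- Let N ≥ 2, let H be a Finsler norm on ℝ^N, let B satisfy assumption (h_B) with p ≥ 2, κ = 0, and parameters γ > 0, Γ > 0, and let q > p−1. Let u be a weak solution of −div(B'(H(∇u))∇H(∇u)) = |u|^{q−1}u in ℝ^N such that u ∈ L^{q+1}(ℝ^N), H(∇u) ∈ L^p(ℝ^N), and N(q+1−p) < p(q+1). Then ∫_{ℝ^N} |u|^{q+1} dx = ∫_{ℝ^N} B'(H(∇u)) H(∇u) dx. -/

import Mathlib

open MeasureTheory Real Set
open scoped RealInnerProductSpace

noncomputable section

/-- A Finsler norm on `ℝ^N`: a norm of class `C²` away from the origin whose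
open unit ball is uniformly convex. -/
def IsFinslerNorm {N : ℕ} (H : EuclideanSpace ℝ (Fin N) → ℝ) : Prop :=
  (∀ x, H x = 0 ↔ x = 0) ∧
  (∀ (c : ℝ) (x : EuclideanSpace ℝ (Fin N)), H (c • x) = |c| * H x) ∧
  (∀ x y, H (x + y) ≤ H x + H y) ∧
  ContDiffOn ℝ 2 H {(0 : EuclideanSpace ℝ (Fin N))}ᶜ ∧
  ∃ Λ : ℝ, 0 < Λ ∧ ∀ ξ : EuclideanSpace ℝ (Fin N), H ξ = 1 →
    ∀ v : EuclideanSpace ℝ (Fin N), ⟪gradient H ξ, v⟫ = 0 →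
      Λ * ‖v‖ ^ 2 ≤ ⟪fderiv ℝ (gradient H) ξ v, v⟫

/-- Assumption `(h_B)` with parameters `p, κ, γ, Γ`. -/
def SatisfiesHB (B : ℝ → ℝ) (p κ γ Γ : ℝ) : Prop :=
  ContDiffOn ℝ 2 B (Set.Ioi 0) ∧ B 0 = 0 ∧ deriv B 0 = 0 ∧
  (∀ t : ℝ, 0 < t → 0 < B t ∧ 0 < deriv B t ∧ 0 < deriv (deriv B) t) ∧
  1 < p ∧ 0 ≤ κ ∧ κ ≤ 1 ∧ 0 < γ ∧ 0 < Γ ∧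
  (∀ t : ℝ, 0 < t →
    γ * (κ + t) ^ (p - 2) * t ≤ deriv B t ∧ deriv B t ≤ Γ * (κ + t) ^ (p - 2) * t) ∧
  (∀ t : ℝ, 0 < t →
    γ * (p - 1) * (κ + t) ^ (p - 2) ≤ deriv (deriv B) t ∧
      deriv (deriv B) t ≤ Γ * (p - 1) * (κ + t) ^ (p - 2))

/-- `u` is a weak solution of `-div(B'(H(∇u)) ∇H(∇u)) = |u|^{q-1} u` in `Ω`. -/
def IsWeakSolutionOn {N : ℕ} (Ω : Set (EuclideanSpace ℝ (Fin N))) (B : ℝ → ℝ)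
    (H : EuclideanSpace ℝ (Fin N) → ℝ) (u : EuclideanSpace ℝ (Fin N) → ℝ) (q : ℝ) : Prop :=
  ∀ φ : EuclideanSpace ℝ (Fin N) → ℝ, ContDiff ℝ 1 φ → HasCompactSupport φ → tsupport φ ⊆ Ω →
    ∫ x in Ω, deriv B (H (gradient u x)) * ⟪gradient H (gradient u x), gradient φ x⟫
      = ∫ x in Ω, |u x| ^ (q - 1) * u x * φ x

/-- Stability of the linearized operator of `u`, tested against `C¹` functions compactly
supported in `S ⊆ Ω` (take `S = Ω` for stability, `S = Ω \ K` for stability outside a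
compact set `K`). -/
def IsStableOn {N : ℕ} (Ω S : Set (EuclideanSpace ℝ (Fin N))) (B : ℝ → ℝ)
    (H : EuclideanSpace ℝ (Fin N) → ℝ) (u : EuclideanSpace ℝ (Fin N) → ℝ) (q : ℝ) : Prop :=
  ∀ φ : EuclideanSpace ℝ (Fin N) → ℝ, ContDiff ℝ 1 φ → HasCompactSupport φ → tsupport φ ⊆ S →
    0 ≤ (∫ x in Ω, deriv (deriv B) (H (gradient u x)) *
            ⟪gradient H (gradient u x), gradient φ x⟫ ^ 2)
        + (∫ x in Ω, deriv B (H (gradient u x)) *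
            ⟪fderiv ℝ (gradient H) (gradient u x) (gradient φ x), gradient φ x⟫)
        - ∫ x in Ω, q * |u x| ^ (q - 1) * φ x ^ 2

open Filter Topology

section FinslerNorm

variable {N : ℕ} {H : EuclideanSpace ℝ (Fin N) → ℝ}

lemma IsFinslerNorm.nonneg (hH : IsFinslerNorm H) (x : EuclideanSpace ℝ (Fin N)) : 0 ≤ H x := by
  obtain ⟨h0, hs, ht, -⟩ := hH
  have h1 := ht x ((-1 : ℝ) • x)
  rw [hs] at h1
  have h2 : H (x + (-1 : ℝ) • x) = 0 := (h0 _).2 (by simp)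
  norm_num at h1 h2
  linarith

lemma IsFinslerNorm.exists_lipschitzWith (hH : IsFinslerNorm H) :
    ∃ C : NNReal, LipschitzWith C H := by
  have hnn := hH.nonneg
  obtain ⟨h0, hs, ht, -⟩ := hH
  let e := EuclideanSpace.basisFun (Fin N) ℝ
  have hC : 0 ≤ ∑ i, H (e i) := Finset.sum_nonneg fun i _ => hnn _
  have hsum : ∀ (s : Finset (Fin N)) (f : Fin N → EuclideanSpace ℝ (Fin N)),
      H (∑ i ∈ s, f i) ≤ ∑ i ∈ s, H (f i) := fun s f =>
    Finset.le_sum_of_subadditive H ((h0 0).2 rfl).le ht s f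
  have hb : ∀ x, H x ≤ (∑ i, H (e i)) * ‖x‖ := by
    intro x
    calc H x = H (∑ i, e.repr x i • e i) := by rw [e.sum_repr]
      _ ≤ ∑ i, H (e.repr x i • e i) := hsum _ _
      _ ≤ ∑ i, H (e i) * ‖x‖ := by
          refine Finset.sum_le_sum fun i _ => ?_
          rw [hs, mul_comm]
          refine mul_le_mul_of_nonneg_left ?_ (hnn _)
          have := PiLp.norm_apply_le (e.repr x) i
          simpa using this
      _ = _ := by rw [Finset.sum_mul]
  refine ⟨⟨_, hC⟩, LipschitzWith.of_le_add_mul _ fun x y => ?_⟩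
  have h1 := ht y (x - y)
  rw [add_sub_cancel] at h1
  have h2 := hb (x - y)
  rw [dist_eq_norm]
  exact h1.trans (add_le_add le_rfl h2)

/-- Euler's identity for the positively homogeneous function `H`. -/
lemma IsFinslerNorm.inner_gradient_self (hH : IsFinslerNorm H) {x : EuclideanSpace ℝ (Fin N)}
    (hx : x ≠ 0) : ⟪gradient H x, x⟫ = H x := by
  obtain ⟨h0, hs, ht, hd, -⟩ := hH
  have hdiff : DifferentiableAt ℝ H x :=
    (hd.contDiffAt (isOpen_compl_singleton.mem_nhds hx)).differentiableAt (by norm_num)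
  have h1 : HasDerivAt (fun t : ℝ => t • x) x 1 := by
    simpa using (hasDerivAt_id (1 : ℝ)).smul_const x
  have h2 : HasDerivAt (fun t : ℝ => H (t • x)) (fderiv ℝ H x x) 1 := by
    have h3 : HasFDerivAt H (fderiv ℝ H x) ((1 : ℝ) • x) := by
      rw [one_smul]; exact hdiff.hasFDerivAt
    exact h3.comp_hasDerivAt (1 : ℝ) h1
  have h4 : HasDerivAt (fun t : ℝ => H (t • x)) (H x) 1 := by
    have h5 : HasDerivAt (fun t : ℝ => t * H x) (H x) 1 := by
      simpa using (hasDerivAt_id (1 : ℝ)).mul_const (H x)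
    refine h5.congr_of_eventuallyEq ?_
    filter_upwards [lt_mem_nhds (zero_lt_one' ℝ)] with t htp
    rw [hs, abs_of_pos htp]
  rw [gradient, InnerProductSpace.toDual_symm_apply]
  exact h2.unique h4

end FinslerNorm

lemma measurable_gradient {N : ℕ} (f : EuclideanSpace ℝ (Fin N) → ℝ) :
    Measurable (gradient f) :=
  (InnerProductSpace.toDual ℝ (EuclideanSpace ℝ (Fin N))).symm.continuous.measurable.comp
    (measurable_fderiv ℝ f)

lemma norm_gradient {N : ℕ} (f : EuclideanSpace ℝ (Fin N) → ℝ) (x : EuclideanSpace ℝ (Fin N)) :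
    ‖gradient f x‖ = ‖fderiv ℝ f x‖ := by
  rw [gradient, LinearIsometryEquiv.norm_map]

lemma SatisfiesHB.deriv_nonneg {B : ℝ → ℝ} {p κ γ Γ : ℝ} (hB : SatisfiesHB B p κ γ Γ) {t : ℝ}
    (ht : 0 ≤ t) : 0 ≤ deriv B t := by
  obtain ⟨-, -, h0, hpos, -⟩ := hB
  rcases ht.eq_or_lt with rfl | ht
  · exact h0.ge
  · exact (hpos t ht).2.1.le

lemma SatisfiesHB.deriv_le_rpow {B : ℝ → ℝ} {p γ Γ : ℝ} (hB : SatisfiesHB B p 0 γ Γ) {t : ℝ}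
    (ht : 0 ≤ t) : deriv B t ≤ Γ * t ^ (p - 1) := by
  obtain ⟨-, -, h0, -, hp, -, -, -, hΓ, hb, -⟩ := hB
  rcases ht.eq_or_lt with rfl | ht
  · rw [h0]; positivity
  · refine (hb t ht).2.trans_eq ?_
    rw [zero_add, mul_assoc, ← rpow_add_one ht.ne']
    congr 2; ring

/-- Smooth cut-offs at scale `n + 1`, with gradients of size `O(1 / (n + 1))`. -/
lemma exists_cutoff_seq (N : ℕ) : ∃ (η : ℕ → EuclideanSpace ℝ (Fin N) → ℝ) (L : ℝ), 0 ≤ L ∧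
    (∀ n, ContDiff ℝ 1 (η n)) ∧ (∀ n, HasCompactSupport (η n)) ∧ (∀ n x, |η n x| ≤ 1) ∧
    (∀ x, ∀ᶠ n in atTop, η n x = 1) ∧
    ∀ n x, ‖gradient (η n) x‖ ≤
      (Metric.closedBall 0 (2 * ((n : ℝ) + 1))).indicator (fun _ => L * ((n : ℝ) + 1)⁻¹) x := by
  let f : ContDiffBump (0 : EuclideanSpace ℝ (Fin N)) := ⟨1, 2, one_pos, one_lt_two⟩
  obtain ⟨L, hL⟩ := (f.contDiff (n := 1)).lipschitzWith_of_hasCompactSupport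
    f.hasCompactSupport one_ne_zero
  have hR : ∀ n : ℕ, 0 < (n : ℝ) + 1 := fun n => by positivity
  have hcd : ∀ n : ℕ, ContDiff ℝ 1 (fun x => f (((n : ℝ) + 1)⁻¹ • x)) := fun n =>
    f.contDiff.comp (contDiff_const_smul _)
  have hts : ∀ n : ℕ, tsupport (fun x => f (((n : ℝ) + 1)⁻¹ • x)) ⊆
      Metric.closedBall 0 (2 * ((n : ℝ) + 1)) := by
    intro n
    refine closure_minimal (fun x hx => ?_) Metric.isClosed_closedBall
    have h1 : ((n : ℝ) + 1)⁻¹ • x ∈ Function.support f := hx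
    rw [f.support_eq, mem_ball_zero_iff, norm_smul, norm_inv, Real.norm_of_nonneg (hR n).le,
      inv_mul_lt_iff₀ (hR n)] at h1
    rw [mem_closedBall_zero_iff]
    change ‖x‖ < ((n : ℝ) + 1) * 2 at h1
    linarith
  refine ⟨fun n x => f (((n : ℝ) + 1)⁻¹ • x), L, L.2, hcd, ?_, ?_, ?_, ?_⟩
  · intro n
    exact HasCompactSupport.of_support_subset_isCompact (isCompact_closedBall _ _)
      (subset_closure.trans (hts n))
  · intro n x
    rw [abs_of_nonneg f.nonneg]
    exact f.le_one
  · intro x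
    filter_upwards [(tendsto_natCast_atTop_atTop (R := ℝ)).eventually_ge_atTop ‖x‖] with n hn
    apply f.one_of_mem_closedBall
    rw [mem_closedBall_zero_iff, norm_smul, norm_inv, Real.norm_of_nonneg (hR n).le,
      inv_mul_le_iff₀ (hR n)]
    change ‖x‖ ≤ ((n : ℝ) + 1) * 1
    linarith
  · intro n x
    rw [norm_gradient]
    by_cases hx : x ∈ Metric.closedBall 0 (2 * ((n : ℝ) + 1))
    · rw [indicator_of_mem hx]
      have h1 := (hL.comp (lipschitzWith_smul (((n : ℝ) + 1)⁻¹)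
        (β := EuclideanSpace ℝ (Fin N))))
      have h2 := norm_fderiv_le_of_lipschitz ℝ h1 (x₀ := x)
      refine h2.trans_eq ?_
      rw [NNReal.coe_mul, coe_nnnorm, norm_inv, Real.norm_of_nonneg (hR n).le]
    · rw [indicator_of_notMem hx, fderiv_of_notMem_tsupport ℝ fun h => hx (hts n h), norm_zero]

/-- Young's inequality for the cut-off error term at scale `R`. -/
lemma young_scaled {p q d R a b : ℝ} (hp : 1 < p) (hq : p - 1 < q) (hR : 0 < R)
    (ha : 0 ≤ a) (hb : 0 ≤ b) :
    a ^ (p - 1) * b * R⁻¹ ≤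
      R ^ (d * (1 / p - 1 / (q + 1)) - 1) * (a ^ p + b ^ (q + 1) + R ^ (-d)) := by
  have hp0 : 0 < p := by linarith
  have hq0 : 0 < q + 1 := by linarith
  have hw : 0 ≤ 1 / p - 1 / (q + 1) :=
    sub_nonneg.2 (one_div_le_one_div_of_le hp0 (by linarith))
  have hw1 : (p - 1) / p ≤ 1 := by rw [div_le_one hp0]; linarith
  have hw2 : 1 / (q + 1) ≤ 1 := by rw [div_le_one hq0]; linarith
  have hw3 : 1 / p - 1 / (q + 1) ≤ 1 := by
    have : 1 / p ≤ 1 := by rw [div_le_one hp0]; linarith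
    have : 0 ≤ 1 / (q + 1) := by positivity
    linarith
  have hx : 0 ≤ a ^ p := rpow_nonneg ha _
  have hy : 0 ≤ b ^ (q + 1) := rpow_nonneg hb _
  have hz : 0 ≤ R ^ (-d) := rpow_nonneg hR.le _
  have h := Real.geom_mean_le_arith_mean3_weighted (div_nonneg (by linarith) hp0.le)
    (one_div_nonneg.2 hq0.le) hw hx hy hz (w₁ := (p - 1) / p) (by field_simp; ring)
  rw [← rpow_mul ha, ← rpow_mul hb, ← rpow_mul hR.le, mul_div_cancel₀ _ hp0.ne',
    mul_one_div_cancel hq0.ne', rpow_one] at h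
  have h1 : R⁻¹ = R ^ (d * (1 / p - 1 / (q + 1)) - 1) * R ^ (-d * (1 / p - 1 / (q + 1))) := by
    rw [← rpow_add hR, ← rpow_neg_one]
    congr 1; ring
  have h2 : a ^ (p - 1) * b * R ^ (-d * (1 / p - 1 / (q + 1))) ≤
      a ^ p + b ^ (q + 1) + R ^ (-d) := by
    refine h.trans ?_
    gcongr
    · exact mul_le_of_le_one_left hx hw1
    · exact mul_le_of_le_one_left hy hw2
    · exact mul_le_of_le_one_left hz hw3
  calc a ^ (p - 1) * b * R⁻¹
      = R ^ (d * (1 / p - 1 / (q + 1)) - 1) *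
        (a ^ (p - 1) * b * R ^ (-d * (1 / p - 1 / (q + 1)))) := by rw [h1]; ring
    _ ≤ _ := mul_le_mul_of_nonneg_left h2 (rpow_nonneg hR.le _)

lemma tendsto_integral_mul_cutoff {α : Type*} [MeasurableSpace α] {μ : Measure α} {f : α → ℝ}
    (hf : Integrable f μ) {η : ℕ → α → ℝ} (hm : ∀ n, AEStronglyMeasurable (η n) μ)
    (hle : ∀ n x, |η n x| ≤ 1) (hone : ∀ x, ∀ᶠ n in atTop, η n x = 1) :
    Tendsto (fun n => ∫ x, f x * η n x ∂μ) atTop (𝓝 (∫ x, f x ∂μ)) := by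
  refine tendsto_integral_of_dominated_convergence (fun x => ‖f x‖)
    (fun n => hf.aestronglyMeasurable.mul (hm n)) hf.norm (fun n => ae_of_all _ fun x => ?_)
    (ae_of_all _ fun x => ?_)
  · rw [norm_mul]
    exact mul_le_of_le_one_right (norm_nonneg _) (hle n x)
  · refine tendsto_const_nhds.congr' ?_
    filter_upwards [hone x] with n hn
    rw [hn, mul_one]

/-- Identity \eqref{b}: for a weak solution with finite energy,
`∫ |u|^{q+1} = ∫ B′(H(∇u)) H(∇u)`. -/
theorem energy_identity {N : ℕ} (hN : 2 ≤ N)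
    (H : EuclideanSpace ℝ (Fin N) → ℝ) (B : ℝ → ℝ)
    (u : EuclideanSpace ℝ (Fin N) → ℝ) (p γ Γ q : ℝ)
    (hH : IsFinslerNorm H) (hB : SatisfiesHB B p 0 γ Γ) (hp : 2 ≤ p)
    (hq : p - 1 < q)
    (hu : ContDiff ℝ 1 u)
    (hsol : IsWeakSolutionOn Set.univ B H u q)
    (huLq : Integrable (fun x => |u x| ^ (q + 1)))
    (hgradLp : Integrable (fun x => H (gradient u x) ^ p))
    (hNq : (N : ℝ) * (q + 1 - p) < p * (q + 1)) :
    (∫ x, |u x| ^ (q + 1)) = ∫ x, deriv B (H (gradient u x)) * H (gradient u x) := by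
  obtain ⟨η, L, hL, hηc, hηs, hηle, hηone, hηgrad⟩ := exists_cutoff_seq N
  obtain ⟨C, hC⟩ := hH.exists_lipschitzWith
  have hΓ : 0 < Γ := hB.2.2.2.2.2.2.2.2.1
  have hB0 : deriv B 0 = 0 := hB.2.2.1
  have hnn := hH.nonneg
  have hH0 : H 0 = 0 := (hH.1 0).2 rfl
  have hHm : Measurable fun x => H (gradient u x) :=
    hC.continuous.measurable.comp (measurable_gradient u)
  have hBm : Measurable fun x => deriv B (H (gradient u x)) := (measurable_deriv B).comp hHm
  have hηm : ∀ n, AEStronglyMeasurable (η n) (volume : Measure (EuclideanSpace ℝ (Fin N))) :=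
    fun n => (hηc n).continuous.aestronglyMeasurable
  -- the flux term is integrable
  have hflux : Integrable (fun x => deriv B (H (gradient u x)) * H (gradient u x)) := by
    refine (hgradLp.const_mul Γ).mono' (hBm.mul hHm).aestronglyMeasurable
      (ae_of_all _ fun x => ?_)
    have h := hnn (gradient u x)
    rw [Real.norm_of_nonneg (mul_nonneg (hB.deriv_nonneg h) h)]
    refine (mul_le_mul_of_nonneg_right (hB.deriv_le_rpow h) h).trans_eq ?_
    rw [mul_assoc]
    congr 1
    rcases h.eq_or_lt with h | h
    · rw [← h, mul_zero, zero_rpow (by linarith)]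
    · rw [← rpow_add_one h.ne', sub_add_cancel]
  let E : ℕ → EuclideanSpace ℝ (Fin N) → ℝ := fun n x =>
    deriv B (H (gradient u x)) * ⟪gradient H (gradient u x), gradient (η n) x⟫ * u x
  let ε : ℕ → ℝ := fun n => ((n : ℝ) + 1) ^ ((N : ℝ) * (1 / p - 1 / (q + 1)) - 1)
  let G : ℕ → EuclideanSpace ℝ (Fin N) → ℝ := fun n x =>
    Γ * C * L * ε n * (H (gradient u x) ^ p + |u x| ^ (q + 1) +
      (Metric.closedBall 0 (2 * ((n : ℝ) + 1))).indicator
        (fun _ => ((n : ℝ) + 1) ^ (-(N : ℝ))) x)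
  have hind : ∀ n : ℕ, Integrable
      ((Metric.closedBall (0 : EuclideanSpace ℝ (Fin N)) (2 * ((n : ℝ) + 1))).indicator
        (fun _ => ((n : ℝ) + 1) ^ (-(N : ℝ)))) := fun n =>
    (integrable_indicator_iff Metric.isClosed_closedBall.measurableSet).2
      (integrableOn_const (hs := measure_closedBall_lt_top.ne))
  have hG : ∀ n, Integrable (G n) := fun n =>
    ((hgradLp.add huLq).add (hind n)).const_mul _
  have hεnn : ∀ n, 0 ≤ ε n := fun n => rpow_nonneg (by positivity) _
  have hEG : ∀ n x, ‖E n x‖ ≤ G n x := by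
    intro n x
    have h := hnn (gradient u x)
    have hgr : ‖gradient H (gradient u x)‖ ≤ C := by
      rw [norm_gradient]; exact norm_fderiv_le_of_lipschitz ℝ hC
    have hηx := hηgrad n x
    have hin : ‖⟪gradient H (gradient u x), gradient (η n) x⟫‖ ≤ C * ‖gradient (η n) x‖ :=
      (norm_inner_le_norm _ _).trans (mul_le_mul_of_nonneg_right hgr (norm_nonneg _))
    have hR : 0 < (n : ℝ) + 1 := by positivity
    have h1 : ‖E n x‖ ≤ Γ * H (gradient u x) ^ (p - 1) * (C * ‖gradient (η n) x‖) * |u x| := by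
      simp only [E, norm_mul]
      rw [Real.norm_of_nonneg (hB.deriv_nonneg h), Real.norm_eq_abs (u x)]
      refine mul_le_mul_of_nonneg_right ?_ (abs_nonneg _)
      refine mul_le_mul (hB.deriv_le_rpow h) ?_ (norm_nonneg _)
        (mul_nonneg hΓ.le (rpow_nonneg h _))
      exact hin
    refine h1.trans ?_
    by_cases hx : x ∈ Metric.closedBall 0 (2 * ((n : ℝ) + 1))
    · simp only [G]
      rw [indicator_of_mem hx] at hηx ⊢
      have hy := young_scaled (d := N) (by linarith : 1 < p) hq hR h (abs_nonneg (u x))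
      have h2 : 0 ≤ H (gradient u x) ^ (p - 1) := rpow_nonneg h _
      calc Γ * H (gradient u x) ^ (p - 1) * (C * ‖gradient (η n) x‖) * |u x|
          ≤ Γ * H (gradient u x) ^ (p - 1) * (C * (L * ((n : ℝ) + 1)⁻¹)) * |u x| := by gcongr
        _ = Γ * C * L * (H (gradient u x) ^ (p - 1) * |u x| * ((n : ℝ) + 1)⁻¹) := by ring
        _ ≤ Γ * C * L * (ε n * (H (gradient u x) ^ p + |u x| ^ (q + 1) +
              ((n : ℝ) + 1) ^ (-(N : ℝ)))) :=
            mul_le_mul_of_nonneg_left hy (by positivity)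
        _ = _ := by ring
    · rw [indicator_of_notMem hx] at hηx
      have h0 : ‖gradient (η n) x‖ = 0 := le_antisymm hηx (norm_nonneg _)
      simp only [G]
      rw [h0, indicator_of_notMem hx, mul_zero, mul_zero, zero_mul]
      have := hεnn n
      have := rpow_nonneg h p
      positivity
  have hEm : ∀ n, AEStronglyMeasurable (E n) volume := fun n =>
    ((hBm.mul (((measurable_gradient H).comp (measurable_gradient u)).inner
      (measurable_gradient (η n)))).mul hu.continuous.measurable).aestronglyMeasurable
  have hEint : ∀ n, Integrable (E n) := fun n =>
    (hG n).mono' (hEm n) (ae_of_all _ (hEG n))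
  -- testing the equation with `u * η n`
  have key : ∀ n, (∫ x, deriv B (H (gradient u x)) * H (gradient u x) * η n x) + ∫ x, E n x
      = ∫ x, |u x| ^ (q + 1) * η n x := by
    intro n
    have h := hsol (fun x => u x * η n x) (hu.mul (hηc n)) (hηs n).mul_left (subset_univ _)
    simp only [Measure.restrict_univ] at h
    rw [← integral_add (hflux.mul_bdd (c := 1) (hηm n) (ae_of_all _ (hηle n))) (hEint n)]
    convert h using 1
    · congr 1
      funext x
      have hg : gradient (fun x => u x * η n x) x
          = u x • gradient (η n) x + η n x • gradient u x := by
        have hd := fderiv_fun_mul (hu.differentiable one_ne_zero x)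
          ((hηc n).differentiable one_ne_zero x)
        simp only [gradient, hd, map_add, map_smul]
      rw [hg, inner_add_right, real_inner_smul_right, real_inner_smul_right]
      simp only [E]
      by_cases hz : gradient u x = 0
      · rw [hz, hH0, hB0]; ring
      · rw [hH.inner_gradient_self hz]; ring
    · congr 1
      funext x
      by_cases hz : u x = 0
      · rw [hz, abs_zero, zero_rpow (by linarith)]; ring
      · have h1 : |u x| ^ (q + 1) = |u x| ^ (q - 1) * (u x * u x) := by
          rw [← abs_mul_abs_self, ← mul_assoc, ← rpow_add_one (abs_ne_zero.2 hz),
            ← rpow_add_one (abs_ne_zero.2 hz)]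
          congr 1; ring
        rw [h1]; ring
  -- the error term vanishes in the limit
  have hε : Tendsto ε atTop (𝓝 0) := by
    have hp0 : 0 < p := by linarith
    have hq0 : 0 < q + 1 := by linarith
    have hlt : 0 < -((N : ℝ) * (1 / p - 1 / (q + 1)) - 1) := by
      have h1 : (N : ℝ) * (1 / p - 1 / (q + 1)) = (N : ℝ) * (q + 1 - p) / (p * (q + 1)) := by
        field_simp
      have h2 : (N : ℝ) * (q + 1 - p) / (p * (q + 1)) < 1 := by
        rwa [div_lt_one (by positivity)]
      linarith
    have h := (tendsto_rpow_neg_atTop hlt).comp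
      (tendsto_atTop_add_const_right atTop (1 : ℝ) (tendsto_natCast_atTop_atTop (R := ℝ)))
    simp only [neg_neg] at h
    exact h
  let K : ℝ := Γ * C * L * ((∫ x, H (gradient u x) ^ p) + (∫ x, |u x| ^ (q + 1)) +
    2 ^ N * volume.real (Metric.closedBall (0 : EuclideanSpace ℝ (Fin N)) 1))
  have hGint : ∀ n, ∫ x, G n x = ε n * K := by
    intro n
    have hR : 0 < (n : ℝ) + 1 := by positivity
    have hball : ∫ x, (Metric.closedBall (0 : EuclideanSpace ℝ (Fin N))
        (2 * ((n : ℝ) + 1))).indicator (fun _ => ((n : ℝ) + 1) ^ (-(N : ℝ))) x =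
        2 ^ N * volume.real (Metric.closedBall (0 : EuclideanSpace ℝ (Fin N)) 1) := by
      rw [integral_indicator Metric.isClosed_closedBall.measurableSet, setIntegral_const,
        Measure.addHaar_real_closedBall' _ _ (by positivity), finrank_euclideanSpace_fin,
        smul_eq_mul, rpow_neg hR.le, rpow_natCast, mul_pow]
      field_simp
    simp only [G]
    have hsum : Integrable fun x => H (gradient u x) ^ p + |u x| ^ (q + 1) := hgradLp.add huLq
    rw [integral_const_mul, integral_add hsum (hind n), hball,
      integral_add hgradLp huLq]
    simp only [K]
    ring
  have hE : Tendsto (fun n => ∫ x, E n x) atTop (𝓝 0) := by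
    refine squeeze_zero_norm (fun n => ?_) (by simpa using hε.mul_const K)
    rw [← hGint n]
    exact norm_integral_le_of_norm_le (hG n) (ae_of_all _ (hEG n))
  have h1 := (tendsto_integral_mul_cutoff hflux hηm hηle hηone).add hE
  have h2 := tendsto_integral_mul_cutoff huLq hηm hηle hηone
  simp only [key, add_zero] at h1
  exact tendsto_nhds_unique h2 h1
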